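/- (Uniqueness of generalized lsc solutions) Assume L : ℝⁿ × ℝⁿ → [0,∞) is continuous, convex in u, and satisfies L(x,u) ≥ Θ(u) with Θ superlinear, and φ : ℝⁿ → [0,∞] is lower semicontinuous. Let W : (0,∞) × ℝⁿ → [0,∞] be lower semicontinuous, satisfy the initial condition liminf_{h→0+, y→x} W(h,y) = φ(x) for all x, the technical conditions D↑W(t,x)(0,0) = 0 and ∃u: D↑W(t,x)(−1,u) < +∞ on dom(W) ∩ ((0,∞)×ℝⁿ), and solve p_t + H(x,−p_x) = 0 for every (t,x) with t > 0 and every (p_t,p_x) ∈ ∂₋W(t,x). Then W = V on (0,∞) × ℝⁿ, where V is the Bolza value function. -/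

import Mathlib

open Filter Topology Metric Set
open scoped RealInnerProductSpace

noncomputable section

abbrev Euc (n : ℕ) := EuclideanSpace ℝ (Fin n)

def contCone {F : Type*} [NormedAddCommGroup F] [NormedSpace ℝ F] (K : Set F) (x : F) : Set F :=
  {v | ∀ ε > 0, ∃ h : ℝ, 0 < h ∧ h < ε ∧ Metric.infDist (x + h • v) K < ε * h}

def Dup {F : Type*} [NormedAddCommGroup F] [NormedSpace ℝ F]
    (W : F → EReal) (x u : F) : EReal :=
  Filter.liminf (fun p : ℝ × F => ((p.1⁻¹ : ℝ) : EReal) * (W (x + p.1 • p.2) - W x))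
    ((𝓝[>] (0:ℝ)) ×ˢ 𝓝 u)

def Ham {n : ℕ} (L : Euc n → Euc n → ℝ) (x p : Euc n) : EReal :=
  ⨆ u : Euc n, ((⟪p, u⟫ - L x u : ℝ) : EReal)

def subdiffP {n : ℕ} (W : ℝ × Euc n → EReal) (q : ℝ × Euc n) : Set (ℝ × Euc n) :=
  {p | ∀ ε > 0, ∀ᶠ z in 𝓝 q,
    W q + ((p.1 * (z.1 - q.1) + ⟪p.2, z.2 - q.2⟫ - ε * ‖z - q‖ : ℝ) : EReal) ≤ W z}

def bolzaValue {n : ℕ} (L : Euc n → Euc n → ℝ) (φ : Euc n → EReal) (t : ℝ) (x : Euc n) : EReal :=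
  sInf {c : EReal | ∃ u : ℝ → Euc n,
    IntervalIntegrable u MeasureTheory.volume 0 t ∧
    IntervalIntegrable (fun s => L (x + ∫ τ in (0:ℝ)..s, u τ) (u s)) MeasureTheory.volume 0 t ∧
    c = ((∫ s in (0:ℝ)..t, L (x + ∫ τ in (0:ℝ)..s, u τ) (u s) : ℝ) : EReal)
        + φ (x + ∫ τ in (0:ℝ)..t, u τ)}

def Superlinear {n : ℕ} (Θ : Euc n → ℝ) : Prop :=
  Filter.Tendsto (fun u : Euc n => Θ u / ‖u‖) (Filter.comap norm Filter.atTop) Filter.atTop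

def negPolar {n : ℕ} (T : Set (Euc n)) : Set (Euc n) :=
  {v | ∀ w ∈ T, ⟪v, w⟫ ≤ 0}

/-- The quadratic penalty of the inf-convolution with parameter `ε`. -/
def quadPen {n : ℕ} (ε : ℝ) (z q : ℝ × Euc n) : ℝ :=
  ((z.1 - q.1) ^ 2 + ‖z.2 - q.2‖ ^ 2) / (2 * ε)

theorem quadPen_nonneg {n : ℕ} {ε : ℝ} (hε : 0 < ε) (z q : ℝ × Euc n) : 0 ≤ quadPen ε z q := by
  unfold quadPen; positivity

theorem quadPen_self {n : ℕ} (ε : ℝ) (z : ℝ × Euc n) : quadPen ε z z = 0 := by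
  simp [quadPen]

theorem continuous_quadPen {n : ℕ} (ε : ℝ) (q : ℝ × Euc n) :
    Continuous fun z => quadPen ε z q := by
  unfold quadPen; fun_prop

theorem quadPen_add {n : ℕ} {ε : ℝ} (hε : 0 < ε) (z q d : ℝ × Euc n) :
    quadPen ε z (q + d) = quadPen ε z q
      + (ε⁻¹ * (q.1 - z.1) * d.1 + ⟪ε⁻¹ • (q.2 - z.2), d.2⟫)
      + (d.1 ^ 2 + ‖d.2‖ ^ 2) / (2 * ε) := by
  have h : ‖z.2 - (q + d).2‖ ^ 2 = ‖z.2 - q.2‖ ^ 2 + 2 * ⟪q.2 - z.2, d.2⟫ + ‖d.2‖ ^ 2 := by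
    have : z.2 - (q + d).2 = -((q.2 - z.2) + d.2) := by simp; abel
    rw [this, norm_neg, norm_add_sq_real, norm_sub_rev z.2]
  unfold quadPen
  rw [h, real_inner_smul_left, Prod.fst_add]
  field_simp
  ring

/-- The inf-convolution of `F` at `q` is attained. -/
theorem exists_infConv_min {n : ℕ} {F : ℝ × Euc n → EReal} (hF : LowerSemicontinuous F)
    (hF0 : ∀ z, 0 ≤ F z) {ε : ℝ} (hε : 0 < ε) {q z₁ : ℝ × Euc n} {c : ℝ}
    (h₁ : F z₁ ≤ ((c - quadPen ε z₁ q : ℝ) : EReal)) :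
    ∃ (m : ℝ) (z₀ : ℝ × Euc n), m ≤ c ∧ F z₀ = ((m - quadPen ε z₀ q : ℝ) : EReal) ∧
      ∀ z, ((m - quadPen ε z q : ℝ) : EReal) ≤ F z := by
  set K : Set (ℝ × Euc n) := {z | quadPen ε z q ≤ c} with hK
  have hpen : Continuous fun z => quadPen ε z q := continuous_quadPen ε q
  have hz₁ : z₁ ∈ K := by
    have := (hF0 z₁).trans h₁
    rw [← EReal.coe_zero, EReal.coe_le_coe_iff] at this
    simpa [hK] using this
  have hKc : IsCompact K := by
    refine Metric.isCompact_of_isClosed_isBounded (isClosed_le hpen continuous_const) ?_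
    refine (Metric.isBounded_closedBall (x := q) (r := 2 * ε * c + 1)).subset fun z hz => ?_
    have hz' : (z.1 - q.1) ^ 2 + ‖z.2 - q.2‖ ^ 2 ≤ c * (2 * ε) := by
      rwa [hK, mem_ofPred_eq, quadPen, div_le_iff₀ (by positivity)] at hz
    rw [mem_closedBall, dist_eq_norm, Prod.norm_def, max_le_iff]
    simp only [Prod.fst_sub, Prod.snd_sub, Real.norm_eq_abs]
    have h1 := sq_abs (z.1 - q.1)
    constructor <;> nlinarith [sq_nonneg (|z.1 - q.1| - 1), sq_nonneg (‖z.2 - q.2‖ - 1),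
      sq_nonneg (z.1 - q.1), sq_nonneg ‖z.2 - q.2‖]
  have hG : LowerSemicontinuous fun z => F z + ((quadPen ε z q : ℝ) : EReal) := by
    refine hF.add' ((continuous_coe_real_ereal.comp hpen).lowerSemicontinuous) fun z => ?_
    exact EReal.continuousAt_add (Or.inr (EReal.coe_ne_bot _)) (Or.inr (EReal.coe_ne_top _))
  obtain ⟨z₀, hz₀, hmin⟩ := (hG.lowerSemicontinuousOn K).exists_isMinOn ⟨z₁, hz₁⟩ hKc
  have key : ∀ z ∈ K, F z₀ + ((quadPen ε z₀ q : ℝ) : EReal) ≤ F z + ((quadPen ε z q : ℝ) : EReal) :=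
    fun z hz => hmin hz
  have hle : F z₀ + ((quadPen ε z₀ q : ℝ) : EReal) ≤ (c : EReal) := by
    refine (key z₁ hz₁).trans ?_
    calc _ ≤ ((c - quadPen ε z₁ q : ℝ) : EReal) + ((quadPen ε z₁ q : ℝ) : EReal) := by gcongr
      _ = _ := by rw [← EReal.coe_add]; simp
  have hfin : F z₀ ≠ ⊤ := by
    intro h
    rw [h, EReal.top_add_coe] at hle
    exact (EReal.coe_lt_top c).not_ge hle
  have hbot : F z₀ ≠ ⊥ := fun h => by simpa [h] using hF0 z₀
  obtain ⟨w, hw⟩ : ∃ w : ℝ, F z₀ = w := ⟨_, (EReal.coe_toReal hfin hbot).symm⟩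
  have hwc : w + quadPen ε z₀ q ≤ c := by
    rw [hw] at hle; exact_mod_cast hle
  refine ⟨w + quadPen ε z₀ q, z₀, hwc, by simp [hw], fun z => ?_⟩
  by_cases hz : z ∈ K
  · have h2 := key z hz
    rw [hw] at h2
    induction hFz : F z with
    | bot => simpa [hFz] using hF0 z
    | top => exact le_top
    | coe v =>
      rw [hFz] at h2
      have h3 : w + quadPen ε z₀ q ≤ v + quadPen ε z q := by exact_mod_cast h2
      exact_mod_cast (by linarith : w + quadPen ε z₀ q - quadPen ε z q ≤ v)
  · refine le_trans ?_ (hF0 z)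
    have : c < quadPen ε z q := not_le.1 hz
    exact_mod_cast (by linarith : w + quadPen ε z₀ q - quadPen ε z q ≤ 0)

theorem abs_le_of_quadPen_le {n : ℕ} {ε ρ C : ℝ} (hε : 0 < ε) (hρ : 0 ≤ ρ)
    (hC : 2 * ε * C ≤ ρ ^ 2) {z q : ℝ × Euc n} (h : quadPen ε z q ≤ C) :
    |z.1 - q.1| ≤ ρ ∧ ‖z.2 - q.2‖ ≤ ρ := by
  rw [quadPen, div_le_iff₀ (by positivity)] at h
  constructor
  · apply abs_le_of_sq_le_sq _ hρ; nlinarith [sq_nonneg ‖z.2 - q.2‖]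
  · apply le_of_sq_le_sq _ hρ; nlinarith [sq_nonneg (z.1 - q.1)]

/-- A point where the inf-convolution of `F` is attained carries a subgradient. -/
theorem mem_subdiffP_of_infConv_min {n : ℕ} {F W : ℝ × Euc n → EReal} {ε m : ℝ} (hε : 0 < ε)
    {q z₀ : ℝ × Euc n} (hFW : F =ᶠ[𝓝 z₀] W) (h₀ : F z₀ = ((m - quadPen ε z₀ q : ℝ) : EReal))
    (hmin : ∀ z, ((m - quadPen ε z q : ℝ) : EReal) ≤ F z) :
    (ε⁻¹ * (q.1 - z₀.1), ε⁻¹ • (q.2 - z₀.2)) ∈ subdiffP W z₀ := by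
  intro κ hκ
  filter_upwards [hFW, Metric.ball_mem_nhds z₀ (by positivity : 0 < κ * ε)] with z hz hzb
  rw [← hz, ← hFW.self_of_nhds, h₀, ← EReal.coe_add]
  refine le_trans ?_ (hmin z)
  rw [EReal.coe_le_coe_iff]
  have h1 : z.1 - z₀.1 ≤ ‖z - z₀‖ ∧ -(z.1 - z₀.1) ≤ ‖z - z₀‖ := by
    have := norm_fst_le (z - z₀)
    rw [Prod.fst_sub, Real.norm_eq_abs] at this
    exact ⟨(le_abs_self _).trans this, (neg_le_abs _).trans this⟩
  have h2 : ‖z.2 - z₀.2‖ ≤ ‖z - z₀‖ := norm_snd_le (z - z₀)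
  rw [mem_ball, dist_eq_norm] at hzb
  have h3 : quadPen ε z q = quadPen ε z₀ q - (ε⁻¹ * (q.1 - z₀.1) * (z.1 - z₀.1)
      + ⟪ε⁻¹ • (q.2 - z₀.2), z.2 - z₀.2⟫)
      + ((z.1 - z₀.1) ^ 2 + ‖z.2 - z₀.2‖ ^ 2) / (2 * ε) := by
    have h : ‖z.2 - q.2‖ ^ 2 =
        ‖z₀.2 - q.2‖ ^ 2 - 2 * ⟪q.2 - z₀.2, z.2 - z₀.2⟫ + ‖z.2 - z₀.2‖ ^ 2 := by
      have : z.2 - q.2 = -((q.2 - z₀.2) - (z.2 - z₀.2)) := by abel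
      rw [this, norm_neg, norm_sub_sq_real, norm_sub_rev z₀.2]
    unfold quadPen
    rw [h, real_inner_smul_left]
    field_simp
    ring
  rw [h3]
  have h4 : ((z.1 - z₀.1) ^ 2 + ‖z.2 - z₀.2‖ ^ 2) / (2 * ε) ≤ κ * ‖z - z₀‖ := by
    rw [div_le_iff₀ (by positivity)]
    nlinarith [norm_nonneg (z - z₀), norm_nonneg (z.2 - z₀.2)]
  linarith

/-- The extension of `W` by the initial datum at time zero and by `⊤` at negative times. -/
def extendInit {n : ℕ} (W : ℝ × Euc n → EReal) (φ : Euc n → EReal) (z : ℝ × Euc n) : EReal :=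
  if 0 < z.1 then W z else if z.1 = 0 then φ z.2 else ⊤

theorem extendInit_of_pos {n : ℕ} {W : ℝ × Euc n → EReal} {φ : Euc n → EReal} {z : ℝ × Euc n}
    (hz : 0 < z.1) : extendInit W φ z = W z := by
  simp [extendInit, hz]

theorem extendInit_eventuallyEq {n : ℕ} {W : ℝ × Euc n → EReal} {φ : Euc n → EReal}
    {z : ℝ × Euc n} (hz : 0 < z.1) : extendInit W φ =ᶠ[𝓝 z] W := by
  filter_upwards [continuous_fst.continuousAt.eventually (lt_mem_nhds hz)] with y hy
  exact extendInit_of_pos hy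

theorem extendInit_nonneg {n : ℕ} {W : ℝ × Euc n → EReal} {φ : Euc n → EReal}
    (hφ0 : ∀ x, 0 ≤ φ x) (hW0 : ∀ q, 0 ≤ W q) (z : ℝ × Euc n) : 0 ≤ extendInit W φ z := by
  unfold extendInit
  split_ifs
  exacts [hW0 z, hφ0 _, le_top]

theorem lowerSemicontinuous_extendInit {n : ℕ} {W : ℝ × Euc n → EReal} {φ : Euc n → EReal}
    (hφlsc : LowerSemicontinuous φ)
    (hWlsc : LowerSemicontinuousOn W {q : ℝ × Euc n | 0 < q.1})
    (hinit : ∀ x : Euc n,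
      φ x ≤ Filter.liminf (fun z : ℝ × Euc n => W z) ((𝓝[>] (0:ℝ)) ×ˢ 𝓝 x)) :
    LowerSemicontinuous (extendInit W φ) := by
  intro z a ha
  rcases lt_trichotomy z.1 0 with hz | hz | hz
  · filter_upwards [continuous_fst.continuousAt.eventually (gt_mem_nhds hz)] with y hy
    simp only [extendInit, hz.not_gt, hz.ne, if_false] at ha
    simpa [extendInit, hy.not_gt, hy.ne] using ha
  · obtain ⟨t, x⟩ := z
    simp only at hz
    subst hz
    simp only [extendInit, lt_irrefl, if_false, if_true] at ha
    have h1 : ∀ᶠ z in (𝓝[>] (0:ℝ)) ×ˢ 𝓝 x, a < W z :=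
      eventually_lt_of_lt_liminf (ha.trans_le (hinit x))
    have h2 : ∀ᶠ z : ℝ × Euc n in 𝓝 (0, x), 0 < z.1 → a < W z := by
      have : (𝓝[>] (0:ℝ)) ×ˢ 𝓝 x = 𝓝[Ioi 0 ×ˢ univ] ((0:ℝ), x) := by
        rw [nhdsWithin_prod_eq, nhdsWithin_univ]
      rw [this, eventually_nhdsWithin_iff] at h1
      filter_upwards [h1] with z hz hz0 using hz ⟨hz0, mem_univ _⟩
    have h3 : ∀ᶠ z : ℝ × Euc n in 𝓝 (0, x), a < φ z.2 :=
      (continuous_snd.tendsto ((0:ℝ), x)).eventually (hφlsc x a ha)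
    filter_upwards [h2, h3] with z hz2 hz3
    unfold extendInit
    split_ifs with h h'
    exacts [hz2 h, hz3, hz3.trans_le le_top]
  · rw [extendInit_of_pos hz] at ha
    have h1 := hWlsc z hz a ha
    rw [IsOpen.nhdsWithin_eq (isOpen_lt continuous_const continuous_fst) hz] at h1
    filter_upwards [h1, extendInit_eventuallyEq (W := W) (φ := φ) hz] with y hy hy'
    rwa [hy']

theorem Superlinear.exists_mul_norm_le {n : ℕ} {Θ : Euc n → ℝ} (h : Superlinear Θ) (A : ℝ) :
    ∃ K > 0, ∀ u, K ≤ ‖u‖ → A * ‖u‖ ≤ Θ u := by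
  have h1 := h.eventually (eventually_ge_atTop A)
  rw [eventually_comap] at h1
  obtain ⟨K, hK⟩ := eventually_atTop.1 h1
  refine ⟨max K 1, by positivity, fun u hu => ?_⟩
  have hpos : 0 < ‖u‖ := one_pos.trans_le ((le_max_right _ _).trans hu)
  exact (le_div_iff₀ hpos).1 (hK ‖u‖ ((le_max_left _ _).trans hu) u rfl)

theorem Superlinear.norm_le_of_le_affine {n : ℕ} {L : Euc n → Euc n → ℝ} {Θ : Euc n → ℝ}
    (h : Superlinear Θ) (hcoer : ∀ x u, Θ u ≤ L x u) (P Q : ℝ) :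
    ∃ M > 0, ∀ x u, L x u ≤ P * ‖u‖ + Q → ‖u‖ ≤ M := by
  obtain ⟨K, hK, hKΘ⟩ := h.exists_mul_norm_le (P + 1)
  refine ⟨max K Q, by positivity, fun x u hu => ?_⟩
  by_contra! hlt
  have h1 := hKΘ u ((le_max_left _ _).trans hlt.le)
  have h2 := hcoer x u
  have h3 := le_max_right K Q
  linarith

theorem uniform_continuity_on_balls {n : ℕ} {L : Euc n → Euc n → ℝ}
    (hLc : Continuous (fun q : Euc n × Euc n => L q.1 q.2)) (R M : ℝ) {η : ℝ} (hη : 0 < η) :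
    ∃ κ > 0, ∀ x y u v, ‖x‖ ≤ R → ‖y‖ ≤ R → ‖u‖ ≤ M → ‖v‖ ≤ M → ‖x - y‖ ≤ κ → ‖u - v‖ ≤ κ →
      L x u ≤ L y v + η := by
  have hK : IsCompact (closedBall (0 : Euc n) R ×ˢ closedBall (0 : Euc n) M) :=
    (isCompact_closedBall _ _).prod (isCompact_closedBall _ _)
  have huc := hK.uniformContinuousOn_of_continuous hLc.continuousOn
  obtain ⟨κ, hκ, h⟩ := Metric.uniformContinuousOn_iff.1 huc η hη
  refine ⟨κ / 2, by positivity, fun x y u v hx hy hu hv hxy huv => ?_⟩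
  have := h (x, u) ⟨by simpa using hx, by simpa using hu⟩ (y, v)
    ⟨by simpa using hy, by simpa using hv⟩ (by
      rw [Prod.dist_eq, dist_eq_norm, dist_eq_norm]
      exact max_lt (by linarith) (by linarith))
  rw [Real.dist_eq] at this
  linarith [(abs_lt.1 this).2]

theorem exists_bound_on_balls {n : ℕ} {L : Euc n → Euc n → ℝ}
    (hLc : Continuous (fun q : Euc n × Euc n => L q.1 q.2)) (R M : ℝ) :
    ∃ B > 0, ∀ x u, ‖x‖ ≤ R → ‖u‖ ≤ M → L x u ≤ B := by
  have hK : IsCompact (closedBall (0 : Euc n) R ×ˢ closedBall (0 : Euc n) M) :=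
    (isCompact_closedBall _ _).prod (isCompact_closedBall _ _)
  obtain ⟨B, hB⟩ := hK.exists_bound_of_continuousOn hLc.continuousOn
  refine ⟨max B 1, by positivity, fun x u hx hu => ?_⟩
  exact (le_abs_self _).trans ((hB (x, u) ⟨by simpa using hx, by simpa using hu⟩).trans
    (le_max_left _ _))

/-- Slowing down the velocity `u` by a factor `c ≥ 1`: the cost of the slowed motion. -/
theorem mul_lagrangian_inv_smul_le {n : ℕ} {L : Euc n → Euc n → ℝ}
    (hconv : ∀ x, ConvexOn ℝ Set.univ (L x)) (x u : Euc n) {c : ℝ} (hc : 1 ≤ c) :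
    c * L x (c⁻¹ • u) ≤ L x u + (c - 1) * L x 0 := by
  have hc0 : 0 < c := one_pos.trans_le hc
  have h := (hconv x).2 (mem_univ u) (mem_univ 0) (inv_nonneg.2 hc0.le)
    (sub_nonneg.2 (inv_le_one_of_one_le₀ hc)) (by ring)
  simp only [smul_zero, add_zero, smul_eq_mul] at h
  calc c * L x (c⁻¹ • u) ≤ c * (c⁻¹ * L x u + (1 - c⁻¹) * L x 0) := by gcongr
    _ = _ := by field_simp

theorem norm_inv_max_smul_le {n : ℕ} {M : ℝ} (hM : 0 < M) (u : Euc n) :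
    ‖(max 1 (‖u‖ / M))⁻¹ • u‖ ≤ M := by
  have h1 : 0 < max 1 (‖u‖ / M) := by positivity
  rw [norm_smul, norm_inv, Real.norm_of_nonneg h1.le, inv_mul_le_iff₀ h1, ← div_le_iff₀ hM]
  exact le_max_right _ _

theorem le_of_subsolution {n : ℕ} {L : Euc n → Euc n → ℝ} {x : Euc n} {p : ℝ × Euc n}
    (h : (p.1 : ℝ) + Ham L x (-p.2) = (0 : EReal)) {c : ℝ} (hc : 0 < c) (u : Euc n) :
    p.1 * c - ⟪p.2, u⟫ ≤ c * L x (c⁻¹ • u) := by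
  have h1 : ((p.1 + (⟪-p.2, c⁻¹ • u⟫ - L x (c⁻¹ • u)) : ℝ) : EReal) ≤ 0 := by
    rw [← h, EReal.coe_add]
    gcongr
    exact le_iSup (fun u => ((⟪-p.2, u⟫ - L x u : ℝ) : EReal)) _
  rw [← EReal.coe_zero, EReal.coe_le_coe_iff, inner_neg_left, real_inner_smul_right] at h1
  have h2 := mul_le_mul_of_nonneg_left h1 hc.le
  have h3 : c * (p.1 + (-(c⁻¹ * ⟪p.2, u⟫) - L x (c⁻¹ • u))) =
      p.1 * c - ⟪p.2, u⟫ - c * L x (c⁻¹ • u) := by field_simp; ring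
  linarith

theorem exists_of_supersolution {n : ℕ} {L : Euc n → Euc n → ℝ} {x : Euc n} {p : ℝ × Euc n}
    (h : (p.1 : ℝ) + Ham L x (-p.2) = (0 : EReal)) {η : ℝ} (hη : 0 < η) :
    ∃ u, -p.1 + ⟪p.2, u⟫ ≤ -L x u + η := by
  by_contra! hcon
  have h1 : Ham L x (-p.2) ≤ ((-p.1 - η : ℝ) : EReal) := by
    refine iSup_le fun u => ?_
    rw [EReal.coe_le_coe_iff, inner_neg_left]
    linarith [hcon u]
  have h2 : (0 : EReal) ≤ ((p.1 + (-p.1 - η) : ℝ) : EReal) := by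
    rw [← h, EReal.coe_add]
    gcongr
  rw [← EReal.coe_zero, EReal.coe_le_coe_iff] at h2
  linarith

/-- One step of proximal aiming: either the inf-convolution is attained at time zero, or there
is a velocity along which it decreases by the running cost, up to a small error. -/
theorem proximal_aiming_step {n : ℕ} {L : Euc n → Euc n → ℝ} {φ : Euc n → EReal}
    {W : ℝ × Euc n → EReal}
    (hF : LowerSemicontinuous (extendInit W φ)) (hF0 : ∀ z, 0 ≤ extendInit W φ z)
    (heq : ∀ z : ℝ × Euc n, 0 < z.1 → ∀ p ∈ subdiffP W z,
      (p.1 : ℝ) + Ham L z.2 (-p.2) = (0 : EReal))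
    {ε ρ C η M r m : ℝ} (hε : 0 < ε) (hρ : 0 ≤ ρ) (hC : 2 * ε * C ≤ ρ ^ 2) (hη : 0 < η)
    (hM : ∀ x u, L x u ≤ ε⁻¹ * ρ * ‖u‖ + (ε⁻¹ * ρ + η) → ‖u‖ ≤ M)
    (hr : 0 < r) (hrM : r * (1 + M ^ 2) / (2 * ε) ≤ η) (hmC : m ≤ C) {q z₁ : ℝ × Euc n}
    (h₁ : extendInit W φ z₁ ≤ ((m - quadPen ε z₁ q : ℝ) : EReal)) :
    (∃ x₀, φ x₀ ≤ (m : EReal) ∧ |q.1| ≤ ρ ∧ ‖x₀ - q.2‖ ≤ ρ) ∨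
    ∃ (u ξ : Euc n) (z : ℝ × Euc n), -ρ ≤ q.1 ∧ ‖u‖ ≤ M ∧ ‖ξ - q.2‖ ≤ ρ ∧
      extendInit W φ z ≤
        ((m + 2 * r * η - r * L ξ u - quadPen ε z (q + (-r, r • u)) : ℝ) : EReal) := by
  obtain ⟨m₀, z₀, hm₀, hz₀, hmin⟩ := exists_infConv_min hF hF0 hε h₁
  have hpen : quadPen ε z₀ q ≤ m₀ := by
    have := hF0 z₀
    rw [hz₀, ← EReal.coe_zero, EReal.coe_le_coe_iff] at this
    linarith
  obtain ⟨ht, hx⟩ := abs_le_of_quadPen_le hε hρ hC (hpen.trans (hm₀.trans hmC))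
  by_cases hpos : 0 < z₀.1
  · right
    have hp := mem_subdiffP_of_infConv_min hε (extendInit_eventuallyEq (φ := φ) hpos) hz₀ hmin
    obtain ⟨u, hu⟩ := exists_of_supersolution (heq z₀ hpos _ hp) hη
    dsimp only at hu
    have hp1 : |ε⁻¹ * (q.1 - z₀.1)| ≤ ε⁻¹ * ρ := by
      rw [abs_mul, abs_of_pos (inv_pos.2 hε), abs_sub_comm]; gcongr
    have hp2 : |⟪ε⁻¹ • (q.2 - z₀.2), u⟫| ≤ ε⁻¹ * ρ * ‖u‖ := by
      refine (abs_real_inner_le_norm _ _).trans ?_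
      rw [norm_smul, norm_inv, Real.norm_of_nonneg hε.le, norm_sub_rev]; gcongr
    have huM : ‖u‖ ≤ M := hM z₀.2 u (by linarith [abs_le.1 hp1, (abs_le.1 hp1).1, (abs_le.1 hp1).2,
      (abs_le.1 hp2).1, (abs_le.1 hp2).2])
    refine ⟨u, z₀.2, z₀, by linarith [(abs_le.1 ht).1, (abs_le.1 ht).2], huM, hx, ?_⟩
    rw [hz₀, EReal.coe_le_coe_iff, quadPen_add hε, real_inner_smul_right, norm_smul,
      Real.norm_of_nonneg hr.le]
    have h2 : ((-r) ^ 2 + (r * ‖u‖) ^ 2) / (2 * ε) ≤ r * η := by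
      calc _ = r * (r * (1 + ‖u‖ ^ 2) / (2 * ε)) := by ring
        _ ≤ r * (r * (1 + M ^ 2) / (2 * ε)) := by gcongr
        _ ≤ _ := by gcongr
    have h3 := mul_le_mul_of_nonneg_left hu hr.le
    nlinarith
  · left
    have h0 : z₀.1 = 0 ∧ extendInit W φ z₀ = φ z₀.2 := by
      have : extendInit W φ z₀ ≠ ⊤ := by rw [hz₀]; exact EReal.coe_ne_top _
      unfold extendInit at this ⊢
      split_ifs at this ⊢ with h
      · exact ⟨h, rfl⟩
      · exact absurd rfl this
    refine ⟨z₀.2, ?_, by simpa [h0.1] using ht, hx⟩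
    rw [← h0.2, hz₀, EReal.coe_le_coe_iff]
    linarith [quadPen_nonneg hε z₀ q]

/-- `x'` can be reached from `x` in time exactly `T` with running cost at most `c`. -/
def Reach {n : ℕ} (L : Euc n → Euc n → ℝ) (T : ℝ) (x x' : Euc n) (c : ℝ) : Prop :=
  ∃ u : ℝ → Euc n,
    IntervalIntegrable u MeasureTheory.volume 0 T ∧
    IntervalIntegrable (fun s => L (x + ∫ τ in (0:ℝ)..s, u τ) (u s)) MeasureTheory.volume 0 T ∧
    x + ∫ τ in (0:ℝ)..T, u τ = x' ∧
    ∫ s in (0:ℝ)..T, L (x + ∫ τ in (0:ℝ)..s, u τ) (u s) ≤ c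

theorem Reach.refl {n : ℕ} (L : Euc n → Euc n → ℝ) (x : Euc n) : Reach L 0 x x 0 :=
  ⟨0, by simp, by simp, by simp, by simp⟩

theorem Reach.mono {n : ℕ} {L : Euc n → Euc n → ℝ} {T : ℝ} {x x' : Euc n} {c c' : ℝ}
    (h : Reach L T x x' c) (hc : c ≤ c') : Reach L T x x' c' := by
  obtain ⟨u, h1, h2, h3, h4⟩ := h
  exact ⟨u, h1, h2, h3, h4.trans hc⟩

theorem Reach.bolzaValue_le {n : ℕ} {L : Euc n → Euc n → ℝ} {φ : Euc n → EReal} {T : ℝ}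
    {x x' : Euc n} {c : ℝ} (h : Reach L T x x' c) :
    bolzaValue L φ T x ≤ (c : EReal) + φ x' := by
  obtain ⟨u, h1, h2, h3, h4⟩ := h
  calc bolzaValue L φ T x
      ≤ ((∫ s in (0:ℝ)..T, L (x + ∫ τ in (0:ℝ)..s, u τ) (u s) : ℝ) : EReal)
        + φ (x + ∫ τ in (0:ℝ)..T, u τ) := sInf_le ⟨u, h1, h2, rfl⟩
    _ ≤ (c : EReal) + φ x' := by rw [h3]; gcongr

theorem Reach.trans {n : ℕ} {L : Euc n → Euc n → ℝ} {T₁ T₂ : ℝ} (hT₁ : 0 ≤ T₁) (hT₂ : 0 ≤ T₂)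
    {x x' x'' : Euc n} {c₁ c₂ : ℝ} (h₁ : Reach L T₁ x x' c₁) (h₂ : Reach L T₂ x' x'' c₂) :
    Reach L (T₁ + T₂) x x'' (c₁ + c₂) := by
  obtain ⟨u₁, hu₁, hL₁, he₁, hc₁⟩ := h₁
  obtain ⟨u₂, hu₂, hL₂, he₂, hc₂⟩ := h₂
  have hle : T₁ ≤ T₁ + T₂ := by linarith
  set u : ℝ → Euc n := fun s => if s ≤ T₁ then u₁ s else u₂ (s - T₁) with hu
  have hI₁ : ∀ s, s ≤ T₁ → 0 ≤ s → ∫ τ in (0:ℝ)..s, u τ = ∫ τ in (0:ℝ)..s, u₁ τ := by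
    intro s hs h0
    refine intervalIntegral.integral_congr_uIoo ?_
    intro τ hτ
    rw [uIoo_of_le h0] at hτ
    simp [hu, hτ.2.le.trans hs]
  have hu1 : IntervalIntegrable u MeasureTheory.volume 0 T₁ := by
    refine hu₁.congr_uIoo fun τ hτ => ?_
    rw [uIoo_of_le hT₁] at hτ
    simp [hu, hτ.2.le]
  have hu₂' : IntervalIntegrable (fun s => u₂ (s - T₁)) MeasureTheory.volume T₁ (T₁ + T₂) := by
    have := hu₂.comp_sub_right T₁
    rwa [zero_add, add_comm T₂] at this
  have hu2 : IntervalIntegrable u MeasureTheory.volume T₁ (T₁ + T₂) := by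
    refine hu₂'.congr_uIoo fun τ hτ => ?_
    rw [uIoo_of_le hle] at hτ
    simp [hu, hτ.1.not_ge]
  have hI₂ : ∀ s, T₁ ≤ s → s ≤ T₁ + T₂ →
      x + ∫ τ in (0:ℝ)..s, u τ = x' + ∫ τ in (0:ℝ)..(s - T₁), u₂ τ := by
    intro s hs hs'
    have hsub : IntervalIntegrable u MeasureTheory.volume T₁ s :=
      hu2.mono_set (by rw [uIcc_of_le hs, uIcc_of_le hle]; exact Icc_subset_Icc le_rfl hs')
    rw [← intervalIntegral.integral_add_adjacent_intervals hu1 hsub, hI₁ T₁ le_rfl hT₁,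
      ← add_assoc, he₁]
    congr 1
    have : ∫ τ in T₁..s, u τ = ∫ τ in T₁..s, u₂ (τ - T₁) := by
      refine intervalIntegral.integral_congr_uIoo ?_
      intro τ hτ
      rw [uIoo_of_le hs] at hτ
      simp [hu, hτ.1.not_ge]
    rw [this, intervalIntegral.integral_comp_sub_right (fun τ => u₂ τ), sub_self]
  set g : ℝ → ℝ := fun s => L (x + ∫ τ in (0:ℝ)..s, u τ) (u s) with hg
  set g₁ : ℝ → ℝ := fun s => L (x + ∫ τ in (0:ℝ)..s, u₁ τ) (u₁ s) with hg₁
  set g₂ : ℝ → ℝ := fun s => L (x' + ∫ τ in (0:ℝ)..s, u₂ τ) (u₂ s) with hg₂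
  have hgg₁ : EqOn g₁ g (uIoo 0 T₁) := by
    intro s hs
    rw [uIoo_of_le hT₁] at hs
    simp only [hg, hg₁, hI₁ s hs.2.le hs.1.le]
    simp [hu, hs.2.le]
  have hgg₂ : EqOn (fun s => g₂ (s - T₁)) g (uIoo T₁ (T₁ + T₂)) := by
    intro s hs
    rw [uIoo_of_le hle] at hs
    simp only [hg, hg₂, hI₂ s hs.1.le hs.2.le]
    simp [hu, hs.1.not_ge]
  have hL₂' : IntervalIntegrable (fun s => g₂ (s - T₁)) MeasureTheory.volume T₁ (T₁ + T₂) := by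
    have := hL₂.comp_sub_right T₁
    rwa [zero_add, add_comm T₂] at this
  have hg1 := hL₁.congr_uIoo hgg₁
  have hg2 := hL₂'.congr_uIoo hgg₂
  refine ⟨u, hu1.trans hu2, hg1.trans hg2, ?_, ?_⟩
  · rw [hI₂ _ hle le_rfl, add_sub_cancel_left, he₂]
  · rw [← intervalIntegral.integral_add_adjacent_intervals hg1 hg2,
      ← intervalIntegral.integral_congr_uIoo hgg₁, ← intervalIntegral.integral_congr_uIoo hgg₂,
      intervalIntegral.integral_comp_sub_right g₂, sub_self, add_sub_cancel_left]
    exact add_le_add hc₁ hc₂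

theorem Reach.of_const_velocity {n : ℕ} {L : Euc n → Euc n → ℝ}
    (hLc : Continuous (fun q : Euc n × Euc n => L q.1 q.2)) {T c : ℝ} (hT : 0 ≤ T) {x v : Euc n}
    (hc : ∀ s ∈ Icc 0 T, L (x + s • v) v ≤ c) : Reach L T x (x + T • v) (T * c) := by
  have hcont : Continuous fun s : ℝ => L (x + s • v) v :=
    hLc.comp (f := fun s : ℝ => (x + s • v, v)) (by fun_prop)
  refine ⟨fun _ => v, by simp, ?_, by simp, ?_⟩
  · simpa using hcont.intervalIntegrable 0 T
  · simp only [intervalIntegral.integral_const, sub_zero]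
    calc _ ≤ ∫ _ in (0:ℝ)..T, c := intervalIntegral.integral_mono_on hT
          (hcont.intervalIntegrable 0 T) (by simp) hc
      _ = T * c := by simp

/-- Bookkeeping along a polygonal path from `x` to `y` of nominal duration `τ`, nominal cost `A`
and length at most `S`, which is run along with modified speed in time `T`. -/
structure AimPath {n : ℕ} (L : Euc n → Euc n → ℝ) (x : Euc n) (K η B M δ R τ : ℝ) (y : Euc n)
    (S A T : ℝ) : Prop where
  reach : Reach L T x y (A + η * τ + (η + B) * (S / M))
  cost_nonneg : 0 ≤ A
  length_nonneg : 0 ≤ S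
  length_le : S ≤ K * τ + A
  dist_le : ‖y - x‖ ≤ S
  time_le : T ≤ (1 - δ) * τ + S * (δ / R + 1 / M)
  le_time : (1 - δ) * τ ≤ T

theorem AimPath.step {n : ℕ} {L : Euc n → Euc n → ℝ} {x y : Euc n}
    {K η B M δ R τ S A T : ℝ} (h : AimPath L x K η B M δ R τ y S A T)
    (hL0 : ∀ x u, 0 ≤ L x u) (hLc : Continuous (fun q : Euc n × Euc n => L q.1 q.2))
    (hconv : ∀ x, ConvexOn ℝ Set.univ (L x)) (hK : ∀ x u, ‖u‖ ≤ K + L x u)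
    {R₀ κ r : ℝ} (hη : 0 ≤ η) (hδ : 0 < δ) (hδ' : δ ≤ 1 / 2) (hR : 0 < R) (hRM : R ≤ M)
    (hτ : 0 ≤ τ) (hr : 0 < r)
    (hfast : ∀ y ξ u, ‖y‖ ≤ R₀ → ‖ξ‖ ≤ R₀ → ‖u‖ ≤ R → ‖y - ξ‖ ≤ κ →
      L y ((1 - δ)⁻¹ • u) ≤ L ξ u + η)
    (hslow : ∀ y ξ v, ‖y‖ ≤ R₀ → ‖ξ‖ ≤ R₀ → ‖v‖ ≤ M → ‖y - ξ‖ ≤ κ → L y v ≤ L ξ v + η)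
    (hB : ∀ ξ, ‖ξ‖ ≤ R₀ → L ξ 0 ≤ B)
    {u ξ : Euc n} (hy : ‖y‖ + r * ‖u‖ ≤ R₀) (hξ : ‖ξ‖ ≤ R₀) (hyξ : ‖y - ξ‖ + r * ‖u‖ ≤ κ) :
    ∃ T', AimPath L x K η B M δ R (τ + r) (y + r • u) (S + r * ‖u‖) (A + r * L ξ u) T' := by
  have hM : 0 < M := hR.trans_le hRM
  obtain ⟨c, hc0, hcu, hcl, hcost⟩ : ∃ c : ℝ, 0 < c ∧ c ≤ (1 - δ) + ‖u‖ * (δ / R + 1 / M) ∧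
      1 - δ ≤ c ∧ ∀ y', ‖y'‖ ≤ R₀ → ‖y' - ξ‖ ≤ κ →
        c * L y' (c⁻¹ • u) ≤ L ξ u + η + (η + B) * (‖u‖ / M) := by
    have hB0 : 0 ≤ B := (hL0 ξ 0).trans (hB ξ hξ)
    by_cases hu : ‖u‖ ≤ R
    · refine ⟨1 - δ, by linarith, by simp; positivity, le_rfl, fun y' hy' hd => ?_⟩
      have h1 := hfast y' ξ u hy' hξ hu hd
      have h2 := hL0 ξ u
      have h3 : 0 ≤ (η + B) * (‖u‖ / M) := by positivity
      nlinarith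
    · rw [not_le] at hu
      have hmax : max 1 (‖u‖ / M) ≤ 1 + ‖u‖ / M :=
        max_le (by linarith [div_nonneg (norm_nonneg u) hM.le]) (by linarith)
      refine ⟨max 1 (‖u‖ / M), by positivity, ?_, by linarith [le_max_left 1 (‖u‖ / M)],
        fun y' hy' hd => ?_⟩
      · have h1 : 1 ≤ ‖u‖ / R := (one_le_div hR).2 hu.le
        have h2 : ‖u‖ * (δ / R + 1 / M) = δ * (‖u‖ / R) + ‖u‖ / M := by ring
        rw [h2]
        nlinarith
      · have h1 := hslow y' ξ _ hy' hξ (norm_inv_max_smul_le hM u) hd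
        have h2 := mul_lagrangian_inv_smul_le hconv ξ u (le_max_left 1 (‖u‖ / M))
        have h3 := hB ξ hξ
        have h4 := hL0 ξ 0
        have h5 := le_max_left 1 (‖u‖ / M)
        generalize max 1 (‖u‖ / M) = c at *
        nlinarith [mul_le_mul_of_nonneg_left h1 (zero_le_one.trans h5),
          mul_le_mul_of_nonneg_left hmax hη,
          mul_le_mul (by linarith : c - 1 ≤ ‖u‖ / M) h3 h4 (by positivity)]
  have hstep : Reach L (r * c) y (y + r • u) (r * (L ξ u + η + (η + B) * (‖u‖ / M))) := by
    have h1 : (r * c) • (c⁻¹ • u) = r • u := by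
      rw [smul_smul, mul_assoc, mul_inv_cancel₀ hc0.ne', mul_one]
    have h2 := Reach.of_const_velocity hLc (T := r * c)
      (c := c⁻¹ * (L ξ u + η + (η + B) * (‖u‖ / M))) (by positivity) (x := y) (v := c⁻¹ • u) ?_
    · rw [h1] at h2
      refine h2.mono (le_of_eq ?_)
      field_simp
    · intro s hs
      have hsn : ‖s • c⁻¹ • u‖ ≤ r * ‖u‖ := by
        rw [norm_smul, norm_smul, norm_inv, Real.norm_of_nonneg hs.1, Real.norm_of_nonneg hc0.le]
        calc _ ≤ (r * c) * (c⁻¹ * ‖u‖) := by gcongr; exact hs.2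
          _ = _ := by field_simp
      rw [le_inv_mul_iff₀ hc0]
      refine hcost _ ((norm_add_le _ _).trans (by linarith)) ?_
      rw [add_sub_right_comm]
      exact (norm_add_le _ _).trans (by linarith)
  refine ⟨T + r * c, ?_, ?_, ?_, ?_, ?_, ?_, ?_⟩
  · have hT : 0 ≤ T := le_trans (mul_nonneg (by linarith) hτ) h.le_time
    refine (h.reach.trans hT (by positivity) hstep).mono (le_of_eq ?_)
    field_simp
    ring
  · have := h.cost_nonneg; have := hL0 ξ u; positivity
  · have := h.length_nonneg; positivity
  · have := h.length_le; nlinarith [hK ξ u]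
  · rw [add_sub_right_comm]
    refine (norm_add_le _ _).trans ?_
    rw [norm_smul, Real.norm_of_nonneg hr.le]
    linarith [h.dist_le]
  · have := h.time_le; nlinarith
  · have := h.le_time; nlinarith

/-- Iterating proximal aiming until time zero is reached. -/
theorem exists_aimPath {n : ℕ} {L : Euc n → Euc n → ℝ} {φ : Euc n → EReal}
    {W : ℝ × Euc n → EReal} (hL0 : ∀ x u, 0 ≤ L x u)
    (hLc : Continuous (fun q : Euc n × Euc n => L q.1 q.2))
    (hconv : ∀ x, ConvexOn ℝ Set.univ (L x))
    (hF : LowerSemicontinuous (extendInit W φ)) (hF0 : ∀ z, 0 ≤ extendInit W φ z)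
    (heq : ∀ z : ℝ × Euc n, 0 < z.1 → ∀ p ∈ subdiffP W z,
      (p.1 : ℝ) + Ham L z.2 (-p.2) = (0 : EReal))
    {t : ℝ} (ht : 0 < t) {x : Euc n} {c : ℝ} (hFt : extendInit W φ (t, x) ≤ (c : EReal))
    {K C S₀ R₀ : ℝ} (hK : ∀ x u, ‖u‖ ≤ K + L x u) (hC : c + 1 ≤ C)
    (hS₀ : ∀ {τ S A : ℝ}, τ ≤ t + 2 → S ≤ K * τ + A → A ≤ C → S ≤ S₀)
    (hR₀ : ‖x‖ + S₀ + 1 ≤ R₀) {R B η δ M ρ κ ε V r : ℝ} (hR : 0 < R)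
    (hη0 : 0 < η) (hη1 : 2 * η * (t + 2) ≤ 1) (hδ0 : 0 < δ) (hδ2 : δ ≤ 1 / 2) (hRM : R ≤ M)
    (hρ0 : 0 < ρ) (hρ1 : ρ ≤ 1) (hρκ : 2 * ρ ≤ κ)
    (hfast : ∀ y ξ u, ‖y‖ ≤ R₀ → ‖ξ‖ ≤ R₀ → ‖u‖ ≤ R → ‖y - ξ‖ ≤ κ →
      L y ((1 - δ)⁻¹ • u) ≤ L ξ u + η)
    (hslow : ∀ y ξ v, ‖y‖ ≤ R₀ → ‖ξ‖ ≤ R₀ → ‖v‖ ≤ M → ‖y - ξ‖ ≤ κ → L y v ≤ L ξ v + η)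
    (hB : ∀ ξ, ‖ξ‖ ≤ R₀ → L ξ 0 ≤ B)
    (hε0 : 0 < ε) (hεC : 2 * ε * C ≤ ρ ^ 2)
    (hV : ∀ x u, L x u ≤ ε⁻¹ * ρ * ‖u‖ + (ε⁻¹ * ρ + η) → ‖u‖ ≤ V)
    (hr0 : 0 < r) (hr1 : r ≤ 1) (hrV : r * V ≤ ρ) (hrε : r * (1 + V ^ 2) / (2 * ε) ≤ η) :
    ∃ (τ : ℝ) (y : Euc n) (S A T : ℝ)
      (x₀ : Euc n), AimPath L x K η B M δ R τ y S A T ∧ A ≤ C ∧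
      φ x₀ ≤ ((c + 2 * τ * η - A : ℝ) : EReal) ∧ |t - τ| ≤ ρ ∧ ‖x₀ - y‖ ≤ ρ := by
  by_contra hnot
  have hloop : ∀ N : ℕ, N * r ≤ t + ρ + r ∧ ∃ (y : Euc n) (S A T : ℝ) (z : ℝ × Euc n),
      AimPath L x K η B M δ R (N * r) y S A T ∧
      extendInit W φ z ≤
        ((c + 2 * (N * r) * η - A - quadPen ε z (t - N * r, y) : ℝ) : EReal) := by
    intro N
    induction N with
    | zero =>
      refine ⟨by simp; positivity, x, 0, 0, 0, (t, x), ⟨?_, ?_, ?_, ?_, ?_, ?_, ?_⟩, ?_⟩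
      · simpa using Reach.refl L x
      all_goals simp [quadPen_self, hFt]
    | succ N ih =>
      obtain ⟨hN, y, S, A, T, z, hpath, hz⟩ := ih
      have hNr : 0 ≤ N * r := by positivity
      have hm : c + 2 * (N * r) * η - A ≤ C := by
        nlinarith [hpath.cost_nonneg]
      have hAC : A ≤ C := by
        have := (hF0 z).trans hz
        rw [← EReal.coe_zero, EReal.coe_le_coe_iff] at this
        nlinarith [quadPen_nonneg hε0 z (t - N * r, y)]
      have hS := hS₀ (by linarith) hpath.length_le hAC
      rcases proximal_aiming_step hF hF0 heq hε0 hρ0.le hεC hη0 hV hr0 hrε hm hz with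
        ⟨x₀, h1, h2, h3⟩ | ⟨u, ξ, z', h1, h2, h3, h4⟩
      · exact absurd ⟨N * r, y, S, A, T, x₀, hpath, hAC, h1, h2, h3⟩ hnot
      · dsimp only at h1 h3
        have hru : r * ‖u‖ ≤ ρ := (mul_le_mul_of_nonneg_left h2 hr0.le).trans hrV
        have hyR : ‖y‖ ≤ ‖x‖ + S₀ := by
          have := norm_add_le (y - x) x
          rw [sub_add_cancel] at this
          linarith [hpath.dist_le]
        have hξR : ‖ξ‖ ≤ R₀ := by
          have := norm_add_le (ξ - y) y
          rw [sub_add_cancel] at this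
          linarith
        obtain ⟨T', hT'⟩ := hpath.step hL0 hLc hconv hK hη0.le hδ0 hδ2 hR hRM hNr hr0 hfast
          hslow hB (u := u) (ξ := ξ) (by linarith) hξR
          (by rw [norm_sub_rev]; linarith)
        have hcast : ((N + 1 : ℕ) : ℝ) * r = N * r + r := by push_cast; ring
        refine ⟨by rw [hcast]; linarith, y + r • u, S + r * ‖u‖, A + r * L ξ u, T', z',
          by rwa [hcast], h4.trans ?_⟩
        rw [EReal.coe_le_coe_iff, hcast, Prod.mk_add_mk,
          show t - N * r + -r = t - (N * r + r) by ring]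
        linarith
  obtain ⟨N, hN⟩ := exists_nat_gt ((t + ρ + r) / r)
  rw [div_lt_iff₀ hr0] at hN
  exact absurd (hloop N).1 hN.not_ge

/-- Supersolutions dominate the value function. -/
theorem bolzaValue_le_of_supersolution {n : ℕ} {L : Euc n → Euc n → ℝ} {Θ : Euc n → ℝ}
    {φ : Euc n → EReal} {W : ℝ × Euc n → EReal}
    (hL0 : ∀ x u, 0 ≤ L x u) (hLc : Continuous (fun q : Euc n × Euc n => L q.1 q.2))
    (hconv : ∀ x, ConvexOn ℝ Set.univ (L x)) (hΘsl : Superlinear Θ)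
    (hcoer : ∀ x u, Θ u ≤ L x u)
    (hF : LowerSemicontinuous (extendInit W φ)) (hF0 : ∀ z, 0 ≤ extendInit W φ z)
    (heq : ∀ z : ℝ × Euc n, 0 < z.1 → ∀ p ∈ subdiffP W z,
      (p.1 : ℝ) + Ham L z.2 (-p.2) = (0 : EReal))
    {t : ℝ} (ht : 0 < t) (x : Euc n) {c γ : ℝ} (hγ : 0 < γ) (hW : W (t, x) ≤ (c : EReal)) :
    bolzaValue L φ t x ≤ ((c + γ : ℝ) : EReal) := by
  have hFt : extendInit W φ (t, x) ≤ (c : EReal) := by rwa [extendInit_of_pos ht]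
  have hc0 : 0 ≤ c := by exact_mod_cast (hF0 (t, x)).trans hFt
  obtain ⟨K, hK0, hKΘ⟩ := hΘsl.exists_mul_norm_le 1
  have hK : ∀ x u, ‖u‖ ≤ K + L x u := by
    intro x u
    rcases le_total K ‖u‖ with h | h
    · linarith [hKΘ u h, hcoer x u]
    · linarith [hL0 x u]
  set C := c + 1 with hC
  have hC0 : 0 < C := by positivity
  set S₀ := K * (t + 2) + C with hS₀
  have hS₀0 : 0 < S₀ := by positivity
  set R₀ := ‖x‖ + S₀ + 1 with hR₀
  set R := 4 * S₀ / t with hR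
  have hR0 : 0 < R := by positivity
  obtain ⟨B, hB0, hB⟩ := exists_bound_on_balls hLc R₀ 1
  obtain ⟨η, hη0, hη1, hηγ⟩ : ∃ η > 0, 2 * η * (t + 2) ≤ 1 ∧ 16 * η * (t + 2) ≤ γ := by
    refine ⟨min (1 / (2 * (t + 2))) (γ / (16 * (t + 2))), by positivity, ?_, ?_⟩
    · have := min_le_left (1 / (2 * (t + 2))) (γ / (16 * (t + 2)))
      rw [le_div_iff₀ (by positivity)] at this; linarith
    · have := min_le_right (1 / (2 * (t + 2))) (γ / (16 * (t + 2)))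
      rw [le_div_iff₀ (by positivity)] at this; linarith
  obtain ⟨κ₁, hκ₁0, hκ₁⟩ := uniform_continuity_on_balls hLc R₀ (2 * R) hη0
  obtain ⟨δ, hδ0, hδ2, hδR, hδB⟩ : ∃ δ > 0, δ ≤ 1 / 2 ∧ 2 * R * δ ≤ κ₁ ∧ 8 * t * B * δ ≤ γ := by
    refine ⟨min (1 / 2) (min (κ₁ / (2 * R)) (γ / (8 * t * B))), by positivity, min_le_left _ _,
      ?_, ?_⟩
    · rw [mul_comm, ← le_div_iff₀ (by positivity)]
      exact (min_le_right _ _).trans (min_le_left _ _)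
    · rw [mul_comm, ← le_div_iff₀ (by positivity)]
      exact (min_le_right _ _).trans (min_le_right _ _)
  obtain ⟨M, hRM, hMδ, hMγ⟩ : ∃ M, R ≤ M ∧ 8 * S₀ ≤ δ * t * M ∧ 4 * (1 + B) * S₀ ≤ γ * M := by
    refine ⟨max R (max (8 * S₀ / (δ * t)) (4 * (1 + B) * S₀ / γ)), le_max_left _ _, ?_, ?_⟩
    · rw [← div_le_iff₀' (by positivity)]
      exact (le_max_left _ _).trans (le_max_right _ _)
    · rw [← div_le_iff₀' (by positivity)]
      exact (le_max_right _ _).trans (le_max_right _ _)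
  have hM0 : 0 < M := hR0.trans_le hRM
  obtain ⟨κ₂, hκ₂0, hκ₂⟩ := uniform_continuity_on_balls hLc R₀ M hη0
  obtain ⟨ρ, hρ0, hρ1, hρκ₁, hρκ₂, hρδ⟩ : ∃ ρ > 0, ρ ≤ 1 ∧ 2 * ρ ≤ κ₁ ∧ 2 * ρ ≤ κ₂ ∧
      4 * ρ ≤ δ * t := by
    refine ⟨min (min 1 (κ₁ / 2)) (min (κ₂ / 2) (δ * t / 4)), by positivity, ?_, ?_, ?_, ?_⟩
    · exact (min_le_left _ _).trans (min_le_left _ _)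
    · linarith [(min_le_left (min 1 (κ₁ / 2)) (min (κ₂ / 2) (δ * t / 4))).trans
        (min_le_right _ _)]
    · linarith [(min_le_right (min 1 (κ₁ / 2)) (min (κ₂ / 2) (δ * t / 4))).trans
        (min_le_left _ _)]
    · linarith [(min_le_right (min 1 (κ₁ / 2)) (min (κ₂ / 2) (δ * t / 4))).trans
        (min_le_right _ _)]
  obtain ⟨ε, hε0, hεC⟩ : ∃ ε > 0, 2 * ε * C ≤ ρ ^ 2 :=
    ⟨ρ ^ 2 / (2 * C), by positivity, by field_simp; rfl⟩
  obtain ⟨V, hV0, hV⟩ := hΘsl.norm_le_of_le_affine hcoer (ε⁻¹ * ρ) (ε⁻¹ * ρ + η)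
  obtain ⟨r, hr0, hr1, hrV, hrε⟩ : ∃ r > 0, r ≤ 1 ∧ r * V ≤ ρ ∧
      r * (1 + V ^ 2) / (2 * ε) ≤ η := by
    refine ⟨min 1 (min (ρ / V) (η * (2 * ε) / (1 + V ^ 2))), by positivity, min_le_left _ _,
      ?_, ?_⟩
    · rw [← le_div_iff₀ (by positivity)]
      exact (min_le_right _ _).trans (min_le_left _ _)
    · rw [div_le_iff₀ (by positivity), ← le_div_iff₀ (by positivity)]
      exact (min_le_right _ _).trans (min_le_right _ _)
  have hfast : ∀ y ξ u, ‖y‖ ≤ R₀ → ‖ξ‖ ≤ R₀ → ‖u‖ ≤ R → ‖y - ξ‖ ≤ min κ₁ κ₂ →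
      L y ((1 - δ)⁻¹ • u) ≤ L ξ u + η := by
    intro y ξ u hy hξ hu hyξ
    have h1 : (1 - δ)⁻¹ ≤ 2 := by
      rw [inv_le_comm₀ (by linarith) two_pos]; linarith
    have h2 : 0 ≤ (1 - δ)⁻¹ := inv_nonneg.2 (by linarith)
    have h3 : (1 - δ)⁻¹ - 1 = δ * (1 - δ)⁻¹ := by
      have : (1 - δ) ≠ 0 := by linarith
      field_simp
      ring
    refine hκ₁ _ _ _ _ hy hξ ?_ (by linarith) (hyξ.trans (min_le_left _ _)) ?_
    · rw [norm_smul, Real.norm_of_nonneg h2]; gcongr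
    · have : (1 - δ)⁻¹ • u - u = (δ * (1 - δ)⁻¹) • u := by rw [← h3, sub_smul, one_smul]
      rw [this, norm_smul, Real.norm_of_nonneg (by positivity)]
      calc _ ≤ δ * 2 * R := by gcongr
        _ ≤ _ := by linarith
  have hslow : ∀ y ξ v, ‖y‖ ≤ R₀ → ‖ξ‖ ≤ R₀ → ‖v‖ ≤ M → ‖y - ξ‖ ≤ min κ₁ κ₂ →
      L y v ≤ L ξ v + η := fun y ξ v hy hξ hv hyξ =>
    hκ₂ _ _ _ _ hy hξ hv hv (hyξ.trans (min_le_right _ _)) (by simpa using hκ₂0.le)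
  have hSle : ∀ {τ S A : ℝ}, τ ≤ t + 2 → S ≤ K * τ + A → A ≤ C → S ≤ S₀ := by
    intro τ S A h1 h2 h3
    nlinarith
  obtain ⟨τ, y, S, A, T, x₀, hpath, hAC, hφ, hτt, hx₀⟩ : ∃ (τ : ℝ) (y : Euc n) (S A T : ℝ)
      (x₀ : Euc n), AimPath L x K η B M δ R τ y S A T ∧ A ≤ C ∧
      φ x₀ ≤ ((c + 2 * τ * η - A : ℝ) : EReal) ∧ |t - τ| ≤ ρ ∧ ‖x₀ - y‖ ≤ ρ :=
    exists_aimPath hL0 hLc hconv hF hF0 heq ht hFt hK le_rfl hSle le_rfl hR0 hη0 hη1 hδ0 hδ2 hRM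
      hρ0 hρ1 (le_min hρκ₁ hρκ₂) hfast hslow (fun ξ hξ => hB ξ 0 hξ (by simp)) hε0 hεC hV hr0 hr1
      hrV hrε
  have hτ := abs_le.1 hτt
  have hS := hSle (by linarith) hpath.length_le hAC
  have hSM : S / M ≤ S₀ / M := by gcongr
  have hS₀M : S₀ / M ≤ δ * t / 8 := by rw [div_le_iff₀ hM0]; linarith
  have hT1 : T ≤ t - ρ := by
    have h1 := hpath.time_le
    have h2 : S * (δ / R + 1 / M) ≤ S₀ * (δ / R + 1 / M) := by gcongr
    have h3 : S₀ * (δ / R + 1 / M) = δ * t / 4 + S₀ / M := by rw [hR]; field_simp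
    have h4 : (1 - δ) * τ ≤ (1 - δ) * (t + ρ) :=
      mul_le_mul_of_nonneg_left (by linarith) (by linarith)
    have h5 : 0 ≤ δ * ρ := by positivity
    linarith
  have hT2 : t - T ≤ 2 * δ * t := by
    have h1 := hpath.le_time
    have h4 : (1 - δ) * (t - ρ) ≤ (1 - δ) * τ :=
      mul_le_mul_of_nonneg_left (by linarith) (by linarith)
    have h5 : 0 ≤ δ * ρ := by positivity
    linarith
  have hρt : ρ ≤ t := by linarith [mul_le_mul_of_nonneg_right hδ2 ht.le]
  have hT0 : 0 ≤ T := le_trans (mul_nonneg (by linarith) (by linarith)) hpath.le_time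
  have hlast : Reach L (t - T) y x₀ ((t - T) * B) := by
    have hpos : 0 < t - T := by linarith
    have hv : ‖(t - T)⁻¹ • (x₀ - y)‖ ≤ 1 := by
      rw [norm_smul, norm_inv, Real.norm_of_nonneg hpos.le, inv_mul_le_iff₀ hpos]
      linarith
    have h1 := Reach.of_const_velocity hLc (x := y) (v := (t - T)⁻¹ • (x₀ - y)) (c := B) hpos.le ?_
    · rwa [smul_smul, mul_inv_cancel₀ hpos.ne', one_smul, add_sub_cancel] at h1
    · intro s hs
      refine hB _ _ ?_ hv
      have h2 : ‖s • (t - T)⁻¹ • (x₀ - y)‖ ≤ 1 := by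
        rw [smul_smul, norm_smul, norm_mul, norm_inv, Real.norm_of_nonneg hpos.le,
          Real.norm_of_nonneg hs.1, ← div_eq_mul_inv]
        exact mul_le_one₀ ((div_le_one hpos).2 hs.2) (norm_nonneg _) (hx₀.trans hρ1)
      have h3 := norm_add_le (y - x) x
      rw [sub_add_cancel] at h3
      refine (norm_add_le _ _).trans ?_
      linarith [hpath.dist_le]
  have htotal := hpath.reach.trans hT0 (by linarith) hlast
  rw [add_sub_cancel] at htotal
  refine htotal.bolzaValue_le.trans ?_
  calc _ ≤ ((A + η * τ + (η + B) * (S / M) + (t - T) * B : ℝ) : EReal)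
        + ((c + 2 * τ * η - A : ℝ) : EReal) := by gcongr
    _ ≤ _ := by
      rw [← EReal.coe_add, EReal.coe_le_coe_iff]
      have h1 : (η + B) * (S / M) ≤ γ / 4 := by
        have hη' : η ≤ 1 := by linarith [mul_pos hη0 ht]
        have h2 : (1 + B) * (S₀ / M) ≤ γ / 4 := by
          rw [← mul_div_assoc, div_le_iff₀ hM0]; linarith
        exact (mul_le_mul (by linarith) hSM (div_nonneg hpath.length_nonneg hM0.le)
          (by positivity)).trans h2
      have h4 : (t - T) * B ≤ γ / 4 := by
        linarith [mul_le_mul_of_nonneg_right hT2 hB0.le]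
      have h5 : 16 * η * τ ≤ 16 * η * (t + 2) := by gcongr; linarith
      linarith

theorem backward_induction {P : ℝ → Prop} {t σ : ℝ} (ht : 0 ≤ t) (hσ : 0 < σ) (hPt : P t)
    (hstep : ∀ s' s, 0 ≤ s' → s' ≤ s → s ≤ t → s - s' ≤ σ → P s → P s') : P 0 := by
  have h : ∀ N : ℕ, P (max 0 (t - N * σ)) := by
    intro N
    induction N with
    | zero => simpa [ht] using hPt
    | succ N ih =>
      have hcast : t - ((N + 1 : ℕ) : ℝ) * σ = t - N * σ - σ := by push_cast; ring
      have hN : 0 ≤ N * σ := by positivity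
      rw [hcast]
      refine hstep _ _ (le_max_left _ _) (max_le_max le_rfl (by linarith))
        (max_le ht (by linarith)) ?_ ih
      rw [sub_le_iff_le_add]
      exact max_le (by linarith [le_max_left 0 (t - N * σ - σ)])
        (by linarith [le_max_right 0 (t - N * σ - σ)])
  obtain ⟨N, hN⟩ := exists_nat_gt (t / σ)
  rw [div_lt_iff₀ hσ] at hN
  have := h N
  rwa [max_eq_left (by linarith)] at this

/-- Propagation of a subsolution backwards along the path `s ↦ x + e + ∫ u`, with time running
at speed `lam`. -/
theorem exists_le_of_subsolution {n : ℕ} {L : Euc n → Euc n → ℝ} {φ : Euc n → EReal}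
    {W : ℝ × Euc n → EReal} (hL0 : ∀ x u, 0 ≤ L x u)
    (hF : LowerSemicontinuous (extendInit W φ)) (hF0 : ∀ z, 0 ≤ extendInit W φ z)
    (heq : ∀ z : ℝ × Euc n, 0 < z.1 → ∀ p ∈ subdiffP W z,
      (p.1 : ℝ) + Ham L z.2 (-p.2) = (0 : EReal))
    {t : ℝ} (ht : 0 < t) {x e : Euc n} {u : ℝ → Euc n} {lam g : ℝ → ℝ} {h c κ ρ ζ : ℝ}
    (hu : IntervalIntegrable u MeasureTheory.volume 0 t)
    (hlam : IntervalIntegrable lam MeasureTheory.volume 0 t) (hlam0 : ∀ s, 0 < lam s)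
    (hg : IntervalIntegrable g MeasureTheory.volume 0 t)
    (hLg : ∀ s ∈ Icc 0 t, ∀ ξ, ‖ξ - (x + ∫ τ in (0:ℝ)..s, u τ)‖ ≤ κ →
      lam s * L ξ ((lam s)⁻¹ • u s) ≤ g s)
    (hκ : 0 < κ) (he : ‖e‖ ≤ κ / 3) (hρ : 0 < ρ) (hρκ : ρ ≤ κ / 3) (hρh : ρ < h) (hζ : 0 < ζ)
    (hc : extendInit W φ (h, x + e + ∫ τ in (0:ℝ)..t, u τ) ≤ (c : EReal)) :
    ∃ z : ℝ × Euc n, extendInit W φ z ≤ ((c + (∫ s in (0:ℝ)..t, g s) + ζ : ℝ) : EReal) ∧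
      |z.1 - (h + ∫ s in (0:ℝ)..t, lam s)| ≤ ρ ∧ ‖z.2 - (x + e)‖ ≤ ρ := by
  have hsub : ∀ {a b : ℝ}, 0 ≤ a → a ≤ b → b ≤ t → uIcc a b ⊆ uIcc 0 t := by
    intro a b ha hab hb
    rw [uIcc_of_le hab, uIcc_of_le ht.le]
    exact Icc_subset_Icc ha hb
  have hg0 : ∀ s ∈ Icc 0 t, 0 ≤ g s := fun s hs =>
    (mul_nonneg (hlam0 s).le (hL0 _ _)).trans
      (hLg s hs (x + ∫ τ in (0:ℝ)..s, u τ) (by simpa using hκ.le))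
  set w : ℝ → ℝ := fun s => lam s + ‖u s‖ with hw
  have hwi : IntervalIntegrable w MeasureTheory.volume 0 t := hlam.add hu.norm
  have hw0 : ∀ s, 0 ≤ w s := fun s => add_nonneg (hlam0 s).le (norm_nonneg _)
  have hc0 : 0 ≤ c := by exact_mod_cast (hF0 _).trans hc
  set G₀ := ∫ s in (0:ℝ)..t, w s with hG₀
  have hG₀0 : 0 ≤ G₀ := intervalIntegral.integral_nonneg ht.le fun s _ => hw0 s
  have hgI : 0 ≤ ∫ s in (0:ℝ)..t, g s := intervalIntegral.integral_nonneg ht.le hg0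
  obtain ⟨ζ', hζ'0, hζ'⟩ : ∃ ζ' > 0, ζ' * G₀ ≤ ζ := by
    refine ⟨ζ / (G₀ + 1), by positivity, ?_⟩
    rw [div_mul_eq_mul_div, div_le_iff₀ (by positivity)]
    nlinarith
  set C := c + (∫ s in (0:ℝ)..t, g s) + ζ with hC
  have hC0 : 0 < C := by positivity
  obtain ⟨ε, hε0, hεC⟩ : ∃ ε > 0, 2 * ε * C ≤ ρ ^ 2 :=
    ⟨ρ ^ 2 / (2 * C), by positivity, by field_simp; rfl⟩
  obtain ⟨σ, hσ0, hσ⟩ : ∃ σ > 0, ∀ s' s, 0 ≤ s' → s' ≤ s → s ≤ t → s - s' ≤ σ →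
      ∫ τ in s'..s, w τ ≤ min (2 * ε * ζ') (κ / 3) := by
    have hcont : ContinuousOn (fun s => ∫ τ in (0:ℝ)..s, w τ) (uIcc 0 t) :=
      intervalIntegral.continuousOn_primitive_interval' hwi left_mem_uIcc
    have huc := isCompact_uIcc.uniformContinuousOn_of_continuous hcont
    obtain ⟨σ, hσ0, hσ⟩ := Metric.uniformContinuousOn_iff.1 huc (min (2 * ε * ζ') (κ / 3))
      (by positivity)
    refine ⟨σ / 2, by positivity, fun s' s h1 h2 h3 h4 => ?_⟩
    rw [uIcc_of_le ht.le] at hσ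
    have := hσ s ⟨h1.trans h2, h3⟩ s' ⟨h1, h2.trans h3⟩ (by
      rw [Real.dist_eq, abs_of_nonneg (by linarith)]; linarith)
    rw [Real.dist_eq, intervalIntegral.integral_interval_sub_left
      (hwi.mono_set (hsub le_rfl (h1.trans h2) h3))
      (hwi.mono_set (hsub le_rfl h1 (h2.trans h3)))] at this
    exact (le_abs_self _).trans this.le
  set q : ℝ → ℝ × Euc n := fun s =>
    (h + ∫ τ in s..t, lam τ, x + e + ∫ τ in (0:ℝ)..s, u τ) with hq
  set m : ℝ → ℝ := fun s => c + (∫ τ in s..t, g τ) + ζ' * ∫ τ in s..t, w τ with hm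
  have hsplit : ∀ {f : ℝ → ℝ} {s' s : ℝ}, IntervalIntegrable f MeasureTheory.volume 0 t →
      0 ≤ s' → s' ≤ s → s ≤ t → ∫ τ in s'..t, f τ = (∫ τ in s'..s, f τ) + ∫ τ in s..t, f τ :=
    fun hf h1 h2 h3 => (intervalIntegral.integral_add_adjacent_intervals
      (hf.mono_set (hsub h1 h2 h3)) (hf.mono_set (hsub (h1.trans h2) h3 le_rfl))).symm
  have hmC : ∀ s, 0 ≤ s → s ≤ t → m s ≤ C := by
    intro s h1 h2
    have h3 := hsplit hg le_rfl h1 h2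
    have h4 := hsplit hwi le_rfl h1 h2
    have h5 : 0 ≤ ∫ τ in (0:ℝ)..s, g τ :=
      intervalIntegral.integral_nonneg h1 fun τ hτ => hg0 τ ⟨hτ.1, hτ.2.trans h2⟩
    have h6 : 0 ≤ ∫ τ in (0:ℝ)..s, w τ := intervalIntegral.integral_nonneg h1 fun τ _ => hw0 τ
    have h7 : ζ' * ∫ τ in s..t, w τ ≤ ζ' * G₀ := by gcongr; linarith
    simp only [hm]
    linarith
  have hP : ∃ z, extendInit W φ z ≤ ((m 0 - quadPen ε z (q 0) : ℝ) : EReal) := by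
    refine backward_induction
      (P := fun s => ∃ z, extendInit W φ z ≤ ((m s - quadPen ε z (q s) : ℝ) : EReal)) ht.le hσ0 ?_
      ?_
    · refine ⟨q t, ?_⟩
      simpa [hq, hm, quadPen_self] using hc
    · rintro s' s h1 h2 h3 h4 ⟨z₁, hz₁⟩
      obtain ⟨m₀, z₀, hm₀, hz₀, hmin⟩ := exists_infConv_min hF hF0 hε0 hz₁
      have hpen : quadPen ε z₀ (q s) ≤ m₀ := by
        have := hF0 z₀
        rw [hz₀, ← EReal.coe_zero, EReal.coe_le_coe_iff] at this
        linarith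
      obtain ⟨hd1, hd2⟩ := abs_le_of_quadPen_le hε0 hρ.le hεC
        (hpen.trans (hm₀.trans (hmC s (h1.trans h2) h3)))
      have hlams : 0 ≤ ∫ τ in s..t, lam τ :=
        intervalIntegral.integral_nonneg h3 fun τ _ => (hlam0 τ).le
      have hpos : 0 < z₀.1 := by
        have := (abs_le.1 hd1).1
        simp only [hq] at this
        linarith
      have hp := heq z₀ hpos _
        (mem_subdiffP_of_infConv_min hε0 (extendInit_eventuallyEq (φ := φ) hpos) hz₀ hmin)
      set p₁ := ε⁻¹ * ((q s).1 - z₀.1) with hp₁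
      set p₂ := ε⁻¹ • ((q s).2 - z₀.2) with hp₂
      have hss := hsub h1 h2 h3
      have hui := hu.mono_set hss
      have hli := hlam.mono_set hss
      have hws := hσ s' s h1 h2 h3 h4
      have hwsplit : ∫ τ in s'..s, w τ = (∫ τ in s'..s, lam τ) + ∫ τ in s'..s, ‖u τ‖ :=
        intervalIntegral.integral_add hli hui.norm
      have hlamI : 0 ≤ ∫ τ in s'..s, lam τ :=
        intervalIntegral.integral_nonneg h2 fun τ _ => (hlam0 τ).le
      have huI : ‖∫ τ in s'..s, u τ‖ ≤ ∫ τ in s'..s, ‖u τ‖ :=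
        intervalIntegral.norm_integral_le_integral_norm h2
      have hsplitu : ∀ {a b : ℝ}, 0 ≤ a → a ≤ b → b ≤ t →
          ∫ τ in (0:ℝ)..b, u τ = (∫ τ in (0:ℝ)..a, u τ) + ∫ τ in a..b, u τ :=
        fun ha hab hb => (intervalIntegral.integral_add_adjacent_intervals
          (hu.mono_set (hsub le_rfl ha (hab.trans hb))) (hu.mono_set (hsub ha hab hb))).symm
      have hqs : q s' = q s + (∫ τ in s'..s, lam τ, -∫ τ in s'..s, u τ) := by
        simp only [hq, Prod.mk_add_mk]
        rw [hsplit hlam h1 h2 h3, hsplitu h1 h2 h3]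
        congr 1
        · ring
        · abel
      have hclose : ∀ τ ∈ Icc s' s, ‖z₀.2 - (x + ∫ τ' in (0:ℝ)..τ, u τ')‖ ≤ κ := by
        intro τ hτ
        have h5 : ‖∫ τ' in τ..s, u τ'‖ ≤ κ / 3 := by
          refine (intervalIntegral.norm_integral_le_integral_norm hτ.2).trans (le_trans ?_
            (hws.trans (min_le_right _ _)))
          have h6 : ∫ τ' in τ..s, ‖u τ'‖ ≤ ∫ τ' in s'..s, ‖u τ'‖ :=
            intervalIntegral.integral_mono_interval hτ.1 hτ.2 le_rfl
              (Eventually.of_forall fun _ => norm_nonneg _) hui.norm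
          linarith
        have h7 : z₀.2 - (x + ∫ τ' in (0:ℝ)..τ, u τ') =
            (z₀.2 - (q s).2) + e + ∫ τ' in τ..s, u τ' := by
          simp only [hq]
          rw [hsplitu (h1.trans hτ.1) hτ.2 h3]
          abel
        rw [h7]
        refine (norm_add₃_le).trans ?_
        linarith
      have hinner : p₁ * (∫ τ in s'..s, lam τ) + ⟪p₂, -∫ τ in s'..s, u τ⟫ ≤ ∫ τ in s'..s, g τ := by
        have h5 : ⟪p₂, ∫ τ in s'..s, u τ⟫ = ∫ τ in s'..s, ⟪p₂, u τ⟫ :=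
          ((innerSL ℝ p₂).intervalIntegral_comp_comm hui).symm
        have h6 : IntervalIntegrable (fun τ => ⟪p₂, u τ⟫) MeasureTheory.volume s' s :=
          ⟨(innerSL ℝ p₂).integrable_comp hui.1, (innerSL ℝ p₂).integrable_comp hui.2⟩
        rw [inner_neg_right, h5, ← sub_eq_add_neg, ← intervalIntegral.integral_const_mul,
          ← intervalIntegral.integral_sub (hli.const_mul _) h6]
        refine intervalIntegral.integral_mono_on h2 ((hli.const_mul _).sub h6) (hg.mono_set hss)
          fun τ hτ => ?_
        exact (le_of_subsolution hp (hlam0 τ) (u τ)).trans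
          (hLg τ ⟨h1.trans hτ.1, hτ.2.trans h3⟩ z₀.2 (hclose τ hτ))
      have hquad : ((∫ τ in s'..s, lam τ) ^ 2 + ‖∫ τ in s'..s, u τ‖ ^ 2) / (2 * ε) ≤
          ζ' * ∫ τ in s'..s, w τ := by
        rw [div_le_iff₀ (by positivity)]
        have h5 := hws.trans (min_le_left _ _)
        have h6 : (∫ τ in s'..s, lam τ) ^ 2 + ‖∫ τ in s'..s, u τ‖ ^ 2 ≤
            (∫ τ in s'..s, w τ) ^ 2 := by
          rw [hwsplit]
          nlinarith [norm_nonneg (∫ τ in s'..s, u τ)]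
        have h7 : 0 ≤ ∫ τ in s'..s, w τ :=
          intervalIntegral.integral_nonneg h2 fun τ _ => hw0 τ
        nlinarith
      refine ⟨z₀, ?_⟩
      rw [hz₀, EReal.coe_le_coe_iff, hqs, quadPen_add hε0]
      simp only [norm_neg]
      rw [← hp₁, ← hp₂]
      simp only [hm] at hm₀ ⊢
      rw [hsplit hg h1 h2 h3, hsplit hwi h1 h2 h3]
      linarith
  obtain ⟨z, hz⟩ := hP
  have hm0 := hmC 0 le_rfl ht.le
  have hpen : quadPen ε z (q 0) ≤ C := by
    have := (hF0 z).trans hz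
    rw [← EReal.coe_zero, EReal.coe_le_coe_iff] at this
    linarith
  obtain ⟨hd1, hd2⟩ := abs_le_of_quadPen_le hε0 hρ.le hεC hpen
  refine ⟨z, hz.trans ?_, by simpa [hq] using hd1, by simpa [hq] using hd2⟩
  rw [EReal.coe_le_coe_iff]
  linarith [quadPen_nonneg hε0 z (q 0)]

/-- Subsolutions are dominated by the cost of every admissible trajectory. -/
theorem le_cost_of_subsolution {n : ℕ} {L : Euc n → Euc n → ℝ} {φ : Euc n → EReal}
    {W : ℝ × Euc n → EReal} (hL0 : ∀ x u, 0 ≤ L x u)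
    (hLc : Continuous (fun q : Euc n × Euc n => L q.1 q.2))
    (hconv : ∀ x, ConvexOn ℝ Set.univ (L x)) (hφ0 : ∀ x, 0 ≤ φ x)
    (hF : LowerSemicontinuous (extendInit W φ)) (hF0 : ∀ z, 0 ≤ extendInit W φ z)
    (hinit : ∀ x : Euc n,
      Filter.liminf (fun z : ℝ × Euc n => W z) ((𝓝[>] (0:ℝ)) ×ˢ 𝓝 x) ≤ φ x)
    (heq : ∀ z : ℝ × Euc n, 0 < z.1 → ∀ p ∈ subdiffP W z,
      (p.1 : ℝ) + Ham L z.2 (-p.2) = (0 : EReal))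
    {t : ℝ} (ht : 0 < t) {x : Euc n} {u : ℝ → Euc n}
    (hu : IntervalIntegrable u MeasureTheory.volume 0 t)
    (hLu : IntervalIntegrable (fun s => L (x + ∫ τ in (0:ℝ)..s, u τ) (u s))
      MeasureTheory.volume 0 t) :
    W (t, x) ≤ ((∫ s in (0:ℝ)..t, L (x + ∫ τ in (0:ℝ)..s, u τ) (u s) : ℝ) : EReal)
      + φ (x + ∫ τ in (0:ℝ)..t, u τ) := by
  set I := ∫ s in (0:ℝ)..t, L (x + ∫ τ in (0:ℝ)..s, u τ) (u s) with hI
  set y₁ := x + ∫ τ in (0:ℝ)..t, u τ with hy₁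
  induction hφ₁ : φ y₁ with
  | bot => exact absurd (hφ0 y₁) (by simp [hφ₁])
  | top => simp
  | coe φ₁ =>
  by_contra! hlt
  rw [← EReal.coe_add, ← extendInit_of_pos (W := W) (φ := φ) (z := (t, x)) ht,
    EReal.lt_iff_exists_real_btwn] at hlt
  obtain ⟨a, ha1, ha2⟩ := hlt
  rw [EReal.coe_lt_coe_iff] at ha1
  obtain ⟨γ, hγ0, hγ⟩ : ∃ γ > 0, a = I + φ₁ + γ := ⟨a - (I + φ₁), by linarith, by ring⟩
  obtain ⟨κ₀, hκ₀0, hκ₀⟩ := Metric.eventually_nhds_iff.1 (hF (t, x) a ha2)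
  set S := ∫ s in (0:ℝ)..t, ‖u s‖ with hS
  have hS0 : 0 ≤ S := intervalIntegral.integral_nonneg ht.le fun _ _ => norm_nonneg _
  set R₀ := ‖x‖ + S + 1 with hR₀
  have hyR : ∀ s ∈ Icc 0 t, ‖x + ∫ τ in (0:ℝ)..s, u τ‖ ≤ ‖x‖ + S := by
    intro s hs
    refine (norm_add_le _ _).trans ?_
    gcongr
    exact (intervalIntegral.norm_integral_le_integral_norm hs.1).trans
      (intervalIntegral.integral_mono_interval le_rfl hs.1 hs.2
        (Eventually.of_forall fun _ => norm_nonneg _) hu.norm)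
  obtain ⟨B, hB0, hB⟩ := exists_bound_on_balls hLc R₀ 0
  obtain ⟨M, hM0, hMκ, hMγ⟩ : ∃ M > 0, S / M ≤ κ₀ / 4 ∧ B / M * S ≤ γ / 4 := by
    refine ⟨max 1 (max (4 * S / κ₀) (4 * B * S / γ)), by positivity, ?_, ?_⟩
    · have h := (le_max_left (4 * S / κ₀) (4 * B * S / γ)).trans (le_max_right 1 _)
      rw [div_le_iff₀ hκ₀0] at h
      rw [div_le_iff₀ (by positivity)]
      linarith
    · have h := (le_max_right (4 * S / κ₀) (4 * B * S / γ)).trans (le_max_right 1 _)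
      rw [div_le_iff₀ hγ0] at h
      rw [div_mul_eq_mul_div, div_le_iff₀ (by positivity)]
      linarith
  obtain ⟨η, hη0, hη⟩ : ∃ η > 0, η * (t + S / M) ≤ γ / 4 :=
    ⟨γ / 4 / (t + S / M), by positivity, by field_simp; rfl⟩
  obtain ⟨κ', hκ'0, hκ'⟩ := uniform_continuity_on_balls hLc R₀ M hη0
  set κ := min κ' 1 with hκ
  have hκ0 : 0 < κ := by positivity
  set lam : ℝ → ℝ := fun s => 1 + ‖u s‖ / M with hlam
  set g : ℝ → ℝ := fun s => L (x + ∫ τ in (0:ℝ)..s, u τ) (u s) + B / M * ‖u s‖ + η * lam s with hg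
  have hlami : IntervalIntegrable lam MeasureTheory.volume 0 t :=
    intervalIntegrable_const.add (hu.norm.div_const M)
  have hlam1 : ∀ s, 1 ≤ lam s := fun s => by
    have : 0 ≤ ‖u s‖ / M := by positivity
    simp only [hlam]
    linarith
  have hgi : IntervalIntegrable g MeasureTheory.volume 0 t :=
    (hLu.add (hu.norm.const_mul _)).add (hlami.const_mul _)
  have hlamI : ∫ s in (0:ℝ)..t, lam s = t + S / M := by
    rw [hlam, intervalIntegral.integral_add intervalIntegrable_const (hu.norm.div_const M),
      intervalIntegral.integral_div]
    simp [hS]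
  have hgI : ∫ s in (0:ℝ)..t, g s = I + B / M * S + η * (t + S / M) := by
    rw [hg, intervalIntegral.integral_add (hLu.add (hu.norm.const_mul _)) (hlami.const_mul _),
      intervalIntegral.integral_add hLu (hu.norm.const_mul _),
      intervalIntegral.integral_const_mul, intervalIntegral.integral_const_mul, hlamI]
  have hLg : ∀ s ∈ Icc 0 t, ∀ ξ, ‖ξ - (x + ∫ τ in (0:ℝ)..s, u τ)‖ ≤ κ →
      lam s * L ξ ((lam s)⁻¹ • u s) ≤ g s := by
    intro s hs ξ hξ
    have hy := hyR s hs
    simp only [hg]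
    generalize x + ∫ τ in (0:ℝ)..s, u τ = y at hξ hy
    have hl := hlam1 s
    have hl0 : 0 < lam s := by linarith
    have hξR : ‖ξ‖ ≤ R₀ := by
      have := norm_add_le (ξ - y) y
      rw [sub_add_cancel] at this
      linarith [min_le_right κ' 1]
    have hv : ‖(lam s)⁻¹ • u s‖ ≤ M := by
      rw [norm_smul, norm_inv, Real.norm_of_nonneg hl0.le, inv_mul_le_iff₀ hl0]
      have : lam s * M = M + ‖u s‖ := by simp only [hlam]; field_simp
      linarith
    have h1 := hκ' ξ y _ _ hξR (by linarith) hv hv (hξ.trans (min_le_left _ _))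
      (by simpa using hκ'0.le)
    have h2 := mul_lagrangian_inv_smul_le hconv y (u s) hl
    have h3 : (lam s - 1) * L y 0 ≤ B / M * ‖u s‖ := by
      calc (lam s - 1) * L y 0 ≤ (lam s - 1) * B := by
            have := hB y 0 (by linarith) (by simp)
            gcongr
        _ = _ := by simp only [hlam]; ring
    have h4 := mul_le_mul_of_nonneg_left h1 hl0.le
    linarith
  obtain ⟨⟨h, y₂⟩, hW, hh0, hh, hy₂⟩ : ∃ z : ℝ × Euc n, W z < ((φ₁ + γ / 4 : ℝ) : EReal) ∧
      0 < z.1 ∧ z.1 < κ₀ / 4 ∧ ‖z.2 - y₁‖ < min (κ / 3) (κ₀ / 4) := by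
    have hlim : Filter.liminf (fun z : ℝ × Euc n => W z) ((𝓝[>] (0:ℝ)) ×ˢ 𝓝 y₁)
        < ((φ₁ + γ / 4 : ℝ) : EReal) := by
      refine (hinit y₁).trans_lt ?_
      rw [hφ₁, EReal.coe_lt_coe_iff]
      linarith
    have hfr := frequently_lt_of_liminf_lt (by isBoundedDefault) hlim
    have hev : ∀ᶠ z : ℝ × Euc n in (𝓝[>] (0:ℝ)) ×ˢ 𝓝 y₁,
        (0 < z.1 ∧ z.1 < κ₀ / 4) ∧ ‖z.2 - y₁‖ < min (κ / 3) (κ₀ / 4) := by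
      refine Eventually.prod_mk (pa := fun r : ℝ => 0 < r ∧ r < κ₀ / 4)
        (pb := fun y : Euc n => ‖y - y₁‖ < min (κ / 3) (κ₀ / 4))
        (Ioo_mem_nhdsGT (by positivity)) ?_
      filter_upwards [Metric.ball_mem_nhds y₁ (by positivity : 0 < min (κ / 3) (κ₀ / 4))]
        with y hy
      rwa [mem_ball, dist_eq_norm] at hy
    obtain ⟨z, hz1, hz2, hz3⟩ := (hfr.and_eventually hev).exists
    exact ⟨z, hz1, hz2.1, hz2.2, hz3⟩
  dsimp only at hh0 hh hy₂
  obtain ⟨ρ, hρ0, hρκ, hρh, hρκ₀⟩ : ∃ ρ > 0, ρ ≤ κ / 3 ∧ ρ < h ∧ ρ < κ₀ / 4 :=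
    ⟨min (κ / 3) (h / 2), by positivity, min_le_left _ _,
      (min_le_right _ _).trans_lt (by linarith), (min_le_right _ _).trans_lt (by linarith)⟩
  have hstart : extendInit W φ (h, x + (y₂ - y₁) + ∫ τ in (0:ℝ)..t, u τ) ≤
      ((φ₁ + γ / 4 : ℝ) : EReal) := by
    have : x + (y₂ - y₁) + ∫ τ in (0:ℝ)..t, u τ = y₂ := by rw [hy₁]; abel
    rw [this, extendInit_of_pos hh0]
    exact hW.le
  obtain ⟨z, hz, hz1, hz2⟩ := exists_le_of_subsolution hL0 hF hF0 heq ht hu hlami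
    (fun s => one_pos.trans_le (hlam1 s)) hgi hLg hκ0 (hy₂.le.trans (min_le_left _ _)) hρ0 hρκ hρh
    (by positivity : 0 < γ / 8) hstart
  have hnear : dist z (t, x) < κ₀ := by
    rw [dist_eq_norm, Prod.norm_def]
    refine max_lt ?_ ?_
    · rw [hlamI] at hz1
      have : 0 ≤ S / M := by positivity
      simp only [Prod.fst_sub, Real.norm_eq_abs]
      rw [abs_lt]
      have := abs_le.1 hz1
      constructor <;> linarith
    · have h1 := norm_add_le (z.2 - (x + (y₂ - y₁))) (y₂ - y₁)
      have h2 : z.2 - (x + (y₂ - y₁)) + (y₂ - y₁) = z.2 - x := by abel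
      rw [h2] at h1
      simp only [Prod.snd_sub]
      linarith [min_le_right (κ / 3) (κ₀ / 4)]
  have hcon := (hκ₀ hnear).trans_le hz
  rw [EReal.coe_lt_coe_iff, hgI] at hcon
  linarith

theorem stmt17 {n : ℕ} (L : Euc n → Euc n → ℝ) (Θ : Euc n → ℝ) (φ : Euc n → EReal)
    (W : ℝ × Euc n → EReal)
    (hL0 : ∀ x u, 0 ≤ L x u)
    (hLc : Continuous (fun q : Euc n × Euc n => L q.1 q.2))
    (hconv : ∀ x, ConvexOn ℝ Set.univ (L x))
    (hΘ0 : ∀ u, 0 ≤ Θ u) (hΘsl : Superlinear Θ) (hcoer : ∀ x u, Θ u ≤ L x u)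
    (hφ0 : ∀ x, 0 ≤ φ x) (hφlsc : LowerSemicontinuous φ)
    (hW0 : ∀ q, 0 ≤ W q)
    (hWlsc : LowerSemicontinuousOn W {q : ℝ × Euc n | 0 < q.1})
    (hinit : ∀ x : Euc n,
      Filter.liminf (fun z : ℝ × Euc n => W z) ((𝓝[>] (0:ℝ)) ×ˢ 𝓝 x) = φ x)
    (htech0 : ∀ t : ℝ, ∀ x : Euc n, 0 < t → W (t, x) ≠ ⊤ →
      Dup W (t, x) ((0:ℝ), (0:Euc n)) = 0)
    (htech1 : ∀ t : ℝ, ∀ x : Euc n, 0 < t → W (t, x) ≠ ⊤ →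
      ∃ u : Euc n, Dup W (t, x) ((-1:ℝ), u) < ⊤)
    (heq : ∀ t : ℝ, ∀ x : Euc n, 0 < t → ∀ p ∈ subdiffP W (t, x),
      (p.1 : ℝ) + Ham L x (-p.2) = (0 : EReal)) :
    ∀ t : ℝ, ∀ x : Euc n, 0 < t → W (t, x) = bolzaValue L φ t x := by
  intro t x ht
  have hF := lowerSemicontinuous_extendInit hφlsc hWlsc fun x => (hinit x).ge
  have hF0 := extendInit_nonneg hφ0 hW0
  have heq' : ∀ z : ℝ × Euc n, 0 < z.1 → ∀ p ∈ subdiffP W z,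
      (p.1 : ℝ) + Ham L z.2 (-p.2) = (0 : EReal) := fun z hz => heq z.1 z.2 hz
  refine le_antisymm ?_ ?_
  · refine le_sInf ?_
    rintro _ ⟨u, hu, hLu, rfl⟩
    exact le_cost_of_subsolution hL0 hLc hconv hφ0 hF hF0 (fun x => (hinit x).le) heq' ht hu hLu
  · refine EReal.le_of_forall_lt_iff_le.1 fun c hc => ?_
    induction hW : W (t, x) with
    | bot => exact absurd (hW0 (t, x)) (by simp [hW])
    | top => simp [hW] at hc
    | coe w =>
      rw [hW, EReal.coe_lt_coe_iff] at hc
      simpa using bolzaValue_le_of_supersolution hL0 hLc hconv hΘsl hcoer hF hF0 heq' ht x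
        (sub_pos.2 hc) hW.le
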